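/- arXiv:2309.08050 — 10 statements merged into one kernel-verified Lean document; each statement's English description precedes it below -/
import Mathlib

section
/- Let α : ℝ → ℝ be Lipschitz continuous, strictly monotone increasing with α(0) = 0, and let t₀ ∈ ℝ. Let v : ℝ → ℝ be differentiable on [t₀, ∞) and satisfy v'(t) + α(v(t)) ≥ 0 for every t ≥ t₀. If v(t₀) ≥ 0, then v(t) ≥ 0 for all t ≥ t₀. (This is the comparison principle underlying control-barrier-function safety: along a trajectory where the barrier derivative satisfies ḣ + α(h) ≥ 0, the 0-superlevel set is forward invariant.) -/
/-- Comparison principle underlying CBF safety: if `v` is differentiable on `[t₀, ∞)`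
(one-sided at `t₀`), satisfies `v'(t) + α(v(t)) ≥ 0` there for an extended class-K
Lipschitz function `α`, and `v(t₀) ≥ 0`, then `v(t) ≥ 0` for all `t ≥ t₀`. -/
theorem cbf_comparison_principle
    (α : ℝ → ℝ) (K : NNReal) (hαLip : LipschitzWith K α)
    (hαMono : StrictMono α) (hα0 : α 0 = 0)
    (t₀ : ℝ) (v v' : ℝ → ℝ)
    (hv : ∀ t, t₀ ≤ t → HasDerivWithinAt v (v' t) (Set.Ici t₀) t)
    (hineq : ∀ t, t₀ ≤ t → v' t + α (v t) ≥ 0)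
    (h0 : v t₀ ≥ 0) :
    ∀ t, t₀ ≤ t → v t ≥ 0 := by
  intro t ht
  suffices h : ∀ ε > 0, -v t ≤ ε by
    linarith [le_of_forall_gt_imp_ge_of_dense h]
  intro ε hε
  refine image_le_of_deriv_right_lt_deriv_boundary
    (f := fun s => -v s) (f' := fun s => -v' s) (B := fun _ => ε) (B' := fun _ => 0)
    (fun s hs => ((hv s hs.1).continuousWithinAt.mono Set.Icc_subset_Ici_self).neg)
    (fun s hs => ((hv s hs.1).mono (Set.Ici_subset_Ici.2 hs.1)).neg)
    (by linarith) (fun s => hasDerivAt_const s ε) ?_ (Set.right_mem_Icc.2 ht)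
  intro s hs hvs
  have hα : α (v s) < 0 := hα0 ▸ hαMono (show v s < 0 by linarith)
  linarith [hineq s hs.1]
end

section
/- Let m ≥ 1, let α₁, …, α_m : ℝ → ℝ each be Lipschitz continuous, strictly monotone increasing with α_i(0) = 0, and let t₀ ∈ ℝ. Let v₀ : ℝ → ℝ and define recursively, for i = 1, …, m, v_i(t) := v_{i−1}'(t) + α_i(v_{i−1}(t)), where v₀, …, v_{m−1} are assumed differentiable on [t₀, ∞). If v_m(t) ≥ 0 for all t ≥ t₀, and v_i(t₀) ≥ 0 for each i = 0, …, m−1, then v_i(t) ≥ 0 for all t ≥ t₀ and each i = 0, …, m−1; in particular v₀(t) ≥ 0 for all t ≥ t₀. (This is the high-order control barrier function invariance principle along a trajectory.) -/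
/-- A function on `[a, ∞)` that starts nonnegative and has positive derivative wherever it is
negative stays nonnegative. -/
theorem nonneg_of_deriv_pos_of_neg {f f' : ℝ → ℝ} {a : ℝ}
    (hf : ∀ t, a ≤ t → HasDerivWithinAt f (f' t) (Set.Ici a) t) (ha : 0 ≤ f a)
    (hpos : ∀ t, a ≤ t → f t < 0 → 0 < f' t) (t : ℝ) (ht : a ≤ t) : 0 ≤ f t := by
  by_contra! hneg
  have hle : -f t ≤ -f t / 2 :=
    image_le_of_deriv_right_lt_deriv_boundary (f := fun s => -f s) (f' := fun s => -f' s)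
      (B := fun _ => -f t / 2) (B' := fun _ => 0) (a := a) (b := t)
      (fun s hs => ((hf s hs.1).continuousWithinAt.mono Set.Icc_subset_Ici_self).neg)
      (fun s hs => ((hf s hs.1).mono (Set.Ici_subset_Ici.2 hs.1)).neg)
      (by linarith) (fun s => hasDerivAt_const s _)
      (fun s hs heq => by linarith [hpos s hs.1 (by linarith)])
      (Set.right_mem_Icc.2 ht)
  linarith

/-- High-order control barrier function invariance principle along a trajectory:
with the chain `v₀, v₁ = v₀' + α₁ ∘ v₀, …, v_m = v_{m-1}' + α_m ∘ v_{m-1}` built from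
Lipschitz extended class-K functions `α₁, …, α_m`, if `v_m(t) ≥ 0` for all `t ≥ t₀`
and `v_i(t₀) ≥ 0` for `i = 0, …, m-1`, then `v_i(t) ≥ 0` for all `t ≥ t₀` and
`i = 0, …, m-1`. -/
theorem hocbf_invariance_principle
    (m : ℕ) (hm : 1 ≤ m)
    (α : ℕ → ℝ → ℝ)
    (hαLip : ∀ i, 1 ≤ i → i ≤ m → ∃ K : NNReal, LipschitzWith K (α i))
    (hαMono : ∀ i, 1 ≤ i → i ≤ m → StrictMono (α i))
    (hα0 : ∀ i, 1 ≤ i → i ≤ m → α i 0 = 0)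
    (t₀ : ℝ) (v v' : ℕ → ℝ → ℝ)
    (hderiv : ∀ i, i < m → ∀ t, t₀ ≤ t →
      HasDerivWithinAt (v i) (v' i t) (Set.Ici t₀) t)
    (hchain : ∀ i, i < m → ∀ t, v (i + 1) t = v' i t + α (i + 1) (v i t))
    (hvm : ∀ t, t₀ ≤ t → v m t ≥ 0)
    (h0 : ∀ i, i < m → v i t₀ ≥ 0) :
    ∀ i, i < m → ∀ t, t₀ ≤ t → v i t ≥ 0 := by
  suffices h : ∀ i, i ≤ m → ∀ t, t₀ ≤ t → 0 ≤ v i t from fun i hi => h i hi.le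
  intro i hi
  induction hi using Nat.decreasingInduction with
  | self => exact hvm
  | of_succ i hi ih =>
    refine nonneg_of_deriv_pos_of_neg (hderiv i hi) (h0 i hi) fun t ht hneg => ?_
    have hα : α (i + 1) (v i t) < 0 := by
      simpa only [hα0 (i + 1) (by omega) hi] using hαMono (i + 1) (by omega) hi hneg
    linarith [ih t ht, hchain i hi t]
end

section
/- (Pointwise doubly robust CBF condition, relative degree 1.) Let h : E → ℝ be differentiable with derivative Dh, and let α : ℝ → ℝ be strictly monotone increasing with α(0) = 0. Assume the map y ↦ L_f h(y) is Lipschitz with constant l_f, the map y ↦ L_g h(y) is Lipschitz with constant l_g in operator norm, and α ∘ h is Lipschitz with constant l_α. Let x, x̂ ∈ E with ‖x − x̂‖ ≤ ε, let u ∈ EuclideanSpace ℝ (Fin q), and let d ∈ EuclideanSpace ℝ (Fin v) with ‖d‖ ≤ γ. If L_f h(x̂) + (L_g h(x̂))(u) + α(h(x̂)) − (l_f + l_g·‖u‖ + l_α)·ε − ‖L_p h(x)‖·γ ≥ 0, then Dh(x)(f(x) + g(x)u + p(x)d) + α(h(x)) ≥ 0. -/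
/-- Pointwise doubly robust CBF condition (relative degree 1): if the robustified
CBF inequality holds at the estimated state `xh` (with margins for the estimation
error `ε` and disturbance bound `γ`), then the true barrier condition
`Dh(x)(f(x) + g(x)u + p(x)d) + α(h(x)) ≥ 0` holds at the true state `x`. -/
theorem pointwise_doubly_robust_cbf
    (n q r : ℕ)
    (f : EuclideanSpace ℝ (Fin n) → EuclideanSpace ℝ (Fin n))
    (g : EuclideanSpace ℝ (Fin n) → (EuclideanSpace ℝ (Fin q) →L[ℝ] EuclideanSpace ℝ (Fin n)))
    (p : EuclideanSpace ℝ (Fin n) → (EuclideanSpace ℝ (Fin r) →L[ℝ] EuclideanSpace ℝ (Fin n)))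
    (h : EuclideanSpace ℝ (Fin n) → ℝ) (hdiff : Differentiable ℝ h)
    (α : ℝ → ℝ) (hαMono : StrictMono α) (hα0 : α 0 = 0)
    (lf lg lα : NNReal)
    (hLf : LipschitzWith lf (fun y => fderiv ℝ h y (f y)))
    (hLg : LipschitzWith lg (fun y => (fderiv ℝ h y).comp (g y)))
    (hLα : LipschitzWith lα (fun y => α (h y)))
    (x xh : EuclideanSpace ℝ (Fin n)) (ε : ℝ) (hε : ‖x - xh‖ ≤ ε)
    (u : EuclideanSpace ℝ (Fin q))
    (d : EuclideanSpace ℝ (Fin r)) (γ : ℝ) (hd : ‖d‖ ≤ γ)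
    (hcond : fderiv ℝ h xh (f xh) + (fderiv ℝ h xh).comp (g xh) u + α (h xh)
      - ((lf : ℝ) + (lg : ℝ) * ‖u‖ + (lα : ℝ)) * ε
      - ‖(fderiv ℝ h x).comp (p x)‖ * γ ≥ 0) :
    fderiv ℝ h x (f x + g x u + p x d) + α (h x) ≥ 0 := by
  have hf : |fderiv ℝ h x (f x) - fderiv ℝ h xh (f xh)| ≤ lf * ‖x - xh‖ := by
    simpa only [Real.norm_eq_abs] using hLf.norm_sub_le x xh
  have hα : |α (h x) - α (h xh)| ≤ lα * ‖x - xh‖ := by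
    simpa only [Real.norm_eq_abs] using hLα.norm_sub_le x xh
  have hg : |(fderiv ℝ h x).comp (g x) u - (fderiv ℝ h xh).comp (g xh) u|
      ≤ lg * ‖x - xh‖ * ‖u‖ :=
    ((fderiv ℝ h x).comp (g x) - (fderiv ℝ h xh).comp (g xh)).le_of_opNorm_le
      (hLg.norm_sub_le x xh) u
  have hp : |(fderiv ℝ h x).comp (p x) d| ≤ ‖(fderiv ℝ h x).comp (p x)‖ * γ :=
    ((fderiv ℝ h x).comp (p x)).le_opNorm_of_le hd
  have hmargin : ((lf : ℝ) + lg * ‖u‖ + lα) * ‖x - xh‖ ≤ (lf + lg * ‖u‖ + lα) * ε := by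
    gcongr
  have hsplit : fderiv ℝ h x (f x + g x u + p x d) = fderiv ℝ h x (f x)
      + (fderiv ℝ h x).comp (g x) u + (fderiv ℝ h x).comp (p x) d := by
    simp only [map_add, ContinuousLinearMap.comp_apply]
  rw [hsplit]
  linarith [(abs_le.mp hf).1, (abs_le.mp hα).1, (abs_le.mp hg).1, (abs_le.mp hp).1]
end

section
/- (Continuous-time doubly robust CBF forward invariance, relative degree 1.) Let h : E → ℝ be differentiable and α : ℝ → ℝ be Lipschitz, strictly monotone increasing with α(0) = 0. Assume y ↦ L_f h(y) is Lipschitz with constant l_f, y ↦ L_g h(y) is Lipschitz with constant l_g in operator norm, and α ∘ h is Lipschitz with constant l_α. Let t₀ ∈ ℝ and let x : ℝ → E, u : ℝ → EuclideanSpace ℝ (Fin q), d : ℝ → EuclideanSpace ℝ (Fin v), x̂ : ℝ → E satisfy, for all t ≥ t₀: (i) x has derivative x'(t) = f(x(t)) + g(x(t)) u(t) + p(x(t)) d(t); (ii) ‖d(t)‖ ≤ γ; (iii) ‖x(t) − x̂(t)‖ ≤ ε; and (iv) the doubly robust CBF condition L_f h(x̂(t)) + (L_g h(x̂(t)))(u(t))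 + α(h(x̂(t))) − (l_f + l_g·‖u(t)‖ + l_α)·ε − ‖L_p h(x(t))‖·γ ≥ 0. If h(x(t₀)) ≥ 0, then h(x(t)) ≥ 0 for all t ≥ t₀. -/
/-- A real function starting at a nonnegative value whose right derivative is positive wherever
the function is negative stays nonnegative. -/
theorem nonneg_of_right_deriv_pos_of_neg {y y' : ℝ → ℝ} {a : ℝ}
    (hcont : ContinuousOn y (Set.Ici a))
    (hderiv : ∀ t, a ≤ t → HasDerivWithinAt y (y' t) (Set.Ici t) t)
    (hpos : ∀ t, a ≤ t → y t < 0 → 0 < y' t) (ha : 0 ≤ y a) :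
    ∀ t, a ≤ t → 0 ≤ y t := by
  intro t ht
  refine le_of_forall_pos_le_add fun δ hδ => ?_
  have key : -y t ≤ δ :=
    image_le_of_deriv_right_lt_deriv_boundary (f := fun s => -y s) (f' := fun s => -y' s)
      (a := a) (b := t) (B := fun _ => δ) (B' := fun _ => 0)
      (hcont.mono Set.Icc_subset_Ici_self).neg (fun s hs => (hderiv s hs.1).neg)
      (by linarith) (fun s => hasDerivAt_const s δ)
      (fun s hs heq => neg_neg_of_pos (hpos s hs.1 (by linarith))) ⟨ht, le_rfl⟩
  linarith


/-- Continuous-time doubly robust CBF forward invariance (relative degree 1):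
along a trajectory of `ẋ = f(x) + g(x)u + p(x)d` with bounded disturbance
`‖d(t)‖ ≤ γ` and bounded estimation error `‖x(t) − x̂(t)‖ ≤ ε`, if the doubly
robust CBF condition holds at the estimates for all `t ≥ t₀` and `h(x(t₀)) ≥ 0`,
then `h(x(t)) ≥ 0` for all `t ≥ t₀` (the safe set is forward invariant). -/
theorem continuous_time_doubly_robust_cbf_invariance
    (n q r : ℕ)
    (f : EuclideanSpace ℝ (Fin n) → EuclideanSpace ℝ (Fin n))
    (g : EuclideanSpace ℝ (Fin n) → (EuclideanSpace ℝ (Fin q) →L[ℝ] EuclideanSpace ℝ (Fin n)))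
    (p : EuclideanSpace ℝ (Fin n) → (EuclideanSpace ℝ (Fin r) →L[ℝ] EuclideanSpace ℝ (Fin n)))
    (h : EuclideanSpace ℝ (Fin n) → ℝ) (hdiff : Differentiable ℝ h)
    (α : ℝ → ℝ) (Kα : NNReal) (hαLip : LipschitzWith Kα α)
    (hαMono : StrictMono α) (hα0 : α 0 = 0)
    (lf lg lα : NNReal)
    (hLf : LipschitzWith lf (fun y => fderiv ℝ h y (f y)))
    (hLg : LipschitzWith lg (fun y => (fderiv ℝ h y).comp (g y)))
    (hLα : LipschitzWith lα (fun y => α (h y)))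
    (t₀ : ℝ) (ε γ : ℝ)
    (x xh : ℝ → EuclideanSpace ℝ (Fin n))
    (u : ℝ → EuclideanSpace ℝ (Fin q))
    (d : ℝ → EuclideanSpace ℝ (Fin r))
    (hxderiv : ∀ t, t₀ ≤ t →
      HasDerivWithinAt x (f (x t) + g (x t) (u t) + p (x t) (d t)) (Set.Ici t₀) t)
    (hd : ∀ t, t₀ ≤ t → ‖d t‖ ≤ γ)
    (hest : ∀ t, t₀ ≤ t → ‖x t - xh t‖ ≤ ε)
    (hcond : ∀ t, t₀ ≤ t →
      fderiv ℝ h (xh t) (f (xh t)) + (fderiv ℝ h (xh t)).comp (g (xh t)) (u t)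
        + α (h (xh t))
        - ((lf : ℝ) + (lg : ℝ) * ‖u t‖ + (lα : ℝ)) * ε
        - ‖(fderiv ℝ h (x t)).comp (p (x t))‖ * γ ≥ 0)
    (h0 : h (x t₀) ≥ 0) :
    ∀ t, t₀ ≤ t → h (x t) ≥ 0 := by
  refine nonneg_of_right_deriv_pos_of_neg
    (y' := fun t => fderiv ℝ h (x t) (f (x t) + g (x t) (u t) + p (x t) (d t)))
    (fun t ht => ((hdiff (x t)).hasFDerivAt.comp_hasDerivWithinAt t
      (hxderiv t ht)).continuousWithinAt)
    (fun t ht => (hdiff (x t)).hasFDerivAt.comp_hasDerivWithinAt t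
      ((hxderiv t ht).mono (Set.Ici_subset_Ici.2 ht)))
    (fun t ht hneg => ?_) h0
  have hα : α (h (x t)) < 0 := hα0 ▸ hαMono hneg
  have hdist : dist (x t) (xh t) ≤ ε := by simpa [dist_eq_norm] using hest t ht
  have hf := (abs_le.1 (hLf.dist_le_mul_of_le hdist)).1
  have hαh := (abs_le.1 (hLα.dist_le_mul_of_le hdist)).1
  have hg : |((fderiv ℝ h (x t)).comp (g (x t)) - (fderiv ℝ h (xh t)).comp (g (xh t))) (u t)|
      ≤ lg * ε * ‖u t‖ := by
    rw [← Real.norm_eq_abs]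
    refine ContinuousLinearMap.le_of_opNorm_le _ ?_ (u t)
    simpa [dist_eq_norm] using hLg.dist_le_mul_of_le hdist
  have hp : |((fderiv ℝ h (x t)).comp (p (x t))) (d t)|
      ≤ ‖(fderiv ℝ h (x t)).comp (p (x t))‖ * γ := by
    rw [← Real.norm_eq_abs]
    exact ContinuousLinearMap.le_opNorm_of_le _ (hd t ht)
  have hg' := (abs_le.1 hg).1
  have hp' := (abs_le.1 hp).1
  have hc := hcond t ht
  simp only [map_add, ContinuousLinearMap.comp_apply, sub_apply]
    at hc hg' hp' ⊢
  linarith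
end

section
/- (Sampled-data doubly robust CBF condition on one sampling interval, relative degree 1.) Let h : E → ℝ be differentiable and α : ℝ → ℝ be strictly monotone increasing with α(0) = 0. Assume y ↦ L_f h(y) is Lipschitz with constant l_f, y ↦ L_g h(y) is Lipschitz with constant l_g in operator norm, α ∘ h is Lipschitz with constant l_α, and there exist Δ, P, Λ ≥ 0 with ‖f(y) + g(y) u_k‖ ≤ Δ, ‖p(y)‖ ≤ P (operator norm), and ‖L_p h(y)‖ ≤ Λ for all y ∈ E. Let t_k ∈ ℝ, T > 0, u_k ∈ EuclideanSpace ℝ (Fin q), and let x : ℝ → E satisfy x'(t) = f(x(t)) + g(x(t)) u_k + p(x(t)) d(t) with ‖d(t)‖ ≤ γ for all t ∈ [t_k, t_k + T]. Let x̂_k ∈ E with ‖x(t_k) − x̂_k‖ ≤ ε and set v̄ := ε + T(Δ + Pγ). If L_f h(x̂_k) + (L_g h(x̂_k))(u_k) + α(h(x̂_k)) − (l_f + l_g·‖u_k‖ + l_α)·v̄ − Λ·γ ≥ 0, then for every t ∈ [t_k, t_k + T], the derivative of t ↦ h(x(t)) satisfies (d/dt)h(x(t)) + α(h(x(t))) ≥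 0. -/
/-- Sampled-data doubly robust CBF condition on one sampling interval (relative
degree 1): under the zero-order-hold input `u_k`, bounded disturbance, and the
robustified CBF inequality at the sampled estimate `x̂_k` with margin
`v̄ = ε + T(Δ + Pγ)`, the barrier derivative condition
`(d/dt)h(x(t)) + α(h(x(t))) ≥ 0` holds throughout `[t_k, t_k + T]`. -/
theorem sampled_data_doubly_robust_cbf_interval
    (n q r : ℕ)
    (f : EuclideanSpace ℝ (Fin n) → EuclideanSpace ℝ (Fin n))
    (g : EuclideanSpace ℝ (Fin n) → (EuclideanSpace ℝ (Fin q) →L[ℝ] EuclideanSpace ℝ (Fin n)))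
    (p : EuclideanSpace ℝ (Fin n) → (EuclideanSpace ℝ (Fin r) →L[ℝ] EuclideanSpace ℝ (Fin n)))
    (h : EuclideanSpace ℝ (Fin n) → ℝ) (hdiff : Differentiable ℝ h)
    (α : ℝ → ℝ) (hαMono : StrictMono α) (hα0 : α 0 = 0)
    (lf lg lα : NNReal)
    (hLf : LipschitzWith lf (fun y => fderiv ℝ h y (f y)))
    (hLg : LipschitzWith lg (fun y => (fderiv ℝ h y).comp (g y)))
    (hLα : LipschitzWith lα (fun y => α (h y)))
    (Δ P Λ : ℝ) (hΔ : 0 ≤ Δ) (hP : 0 ≤ P) (hΛ : 0 ≤ Λ)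
    (uk : EuclideanSpace ℝ (Fin q))
    (hfg : ∀ y, ‖f y + g y uk‖ ≤ Δ)
    (hp : ∀ y, ‖p y‖ ≤ P)
    (hLp : ∀ y, ‖(fderiv ℝ h y).comp (p y)‖ ≤ Λ)
    (tk T : ℝ) (hT : 0 < T)
    (x : ℝ → EuclideanSpace ℝ (Fin n))
    (d : ℝ → EuclideanSpace ℝ (Fin r)) (γ : ℝ)
    (hxderiv : ∀ t ∈ Set.Icc tk (tk + T),
      HasDerivWithinAt x (f (x t) + g (x t) uk + p (x t) (d t)) (Set.Icc tk (tk + T)) t)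
    (hd : ∀ t ∈ Set.Icc tk (tk + T), ‖d t‖ ≤ γ)
    (xhk : EuclideanSpace ℝ (Fin n)) (ε : ℝ) (hest : ‖x tk - xhk‖ ≤ ε)
    (hcond : fderiv ℝ h xhk (f xhk) + (fderiv ℝ h xhk).comp (g xhk) uk + α (h xhk)
      - ((lf : ℝ) + (lg : ℝ) * ‖uk‖ + (lα : ℝ)) * (ε + T * (Δ + P * γ))
      - Λ * γ ≥ 0) :
    ∀ t ∈ Set.Icc tk (tk + T),
      derivWithin (fun s => h (x s)) (Set.Icc tk (tk + T)) t + α (h (x t)) ≥ 0 := by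
  intro t ht
  have htk : tk ∈ Set.Icc tk (tk + T) := ⟨le_rfl, by linarith⟩
  have hγ : 0 ≤ γ := (norm_nonneg _).trans (hd t ht)
  have hspeed : ∀ s ∈ Set.Icc tk (tk + T),
      ‖f (x s) + g (x s) uk + p (x s) (d s)‖ ≤ Δ + P * γ := fun s hs =>
    norm_add_le_of_le (hfg _) ((p (x s)).le_of_opNorm_le_of_le (hp _) (hd s hs))
  have hmove : ‖x t - x tk‖ ≤ (Δ + P * γ) * ‖t - tk‖ :=
    (convex_Icc tk (tk + T)).norm_image_sub_le_of_norm_hasDerivWithin_le hxderiv hspeed htk ht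
  have htime : ‖t - tk‖ ≤ T := by
    rw [Real.norm_eq_abs, abs_le]
    constructor <;> linarith [ht.1, ht.2]
  have hdist : dist (x t) xhk ≤ ε + T * (Δ + P * γ) := by
    have hsum := dist_triangle (x t) (x tk) xhk
    rw [dist_eq_norm (x t) (x tk), dist_eq_norm (x tk) xhk] at hsum
    have := mul_le_mul_of_nonneg_left htime (by positivity : 0 ≤ Δ + P * γ)
    linarith
  have hf := (abs_le.1 (hLf.dist_le_mul_of_le hdist)).1
  have hα := (abs_le.1 (hLα.dist_le_mul_of_le hdist)).1
  have hg : ‖((fderiv ℝ h (x t)).comp (g (x t)) - (fderiv ℝ h xhk).comp (g xhk)) uk‖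
      ≤ lg * (ε + T * (Δ + P * γ)) * ‖uk‖ :=
    ContinuousLinearMap.le_of_opNorm_le _
      ((dist_eq_norm _ _).symm.trans_le (hLg.dist_le_mul_of_le hdist)) uk
  have hg' := (abs_le.1 hg).1
  have hp' : -(Λ * γ) ≤ (fderiv ℝ h (x t)).comp (p (x t)) (d t) :=
    (abs_le.1 (((fderiv ℝ h (x t)).comp (p (x t))).le_of_opNorm_le_of_le
      (hLp _) (hd t ht))).1
  have hderiv : derivWithin (fun s => h (x s)) (Set.Icc tk (tk + T)) t
      = fderiv ℝ h (x t) (f (x t) + g (x t) uk + p (x t) (d t)) :=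
    ((hdiff (x t)).hasFDerivAt.comp_hasDerivWithinAt t (hxderiv t ht)).derivWithin
      (uniqueDiffOn_Icc (by linarith) t ht)
  rw [hderiv, map_add, map_add]
  simp only [sub_apply, ContinuousLinearMap.comp_apply] at hf hα hg' hp' hcond
  linarith
end

section
/- (Sampled-data doubly robust CBF forward invariance with piecewise-constant control, relative degree 1.) Let h : E → ℝ be differentiable and α : ℝ → ℝ be Lipschitz, strictly monotone increasing with α(0) = 0. Assume y ↦ L_f h(y) is Lipschitz with constant l_f, y ↦ L_g h(y) is Lipschitz with constant l_g in operator norm, α ∘ h is Lipschitz with constant l_α, and there exist Δ, P, Λ ≥ 0 with ‖f(y) + g(y) u‖ ≤ Δ for every applied input u, ‖p(y)‖ ≤ P, and ‖L_p h(y)‖ ≤ Λ for all y ∈ E. Fix t₀ ∈ ℝ, T > 0, and set t_k := t₀ + kT for k ∈ ℕ. Let x : ℝ → E and d : ℝ → EuclideanSpace ℝ (Fin v) with ‖d(t)‖ ≤ γ, and for each k ∈ ℕ let u_k ∈ EuclideanSpace ℝ (Fin q) and x̂_k ∈ E be such that: (i) for all t ∈ [t_k, t_{k+1}], x'(t) =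 f(x(t)) + g(x(t)) u_k + p(x(t)) d(t); (ii) ‖x(t_k) − x̂_k‖ ≤ ε; and (iii) with v̄ := ε + T(Δ + Pγ), L_f h(x̂_k) + (L_g h(x̂_k))(u_k) + α(h(x̂_k)) − (l_f + l_g·‖u_k‖ + l_α)·v̄ − Λ·γ ≥ 0. If h(x(t₀)) ≥ 0, then h(x(t)) ≥ 0 for all t ≥ t₀. -/
/-- A function on `[a, b]` that starts nonnegative and whose derivative is positive wherever the
function is negative stays nonnegative. -/
theorem nonneg_of_hasDerivWithinAt_of_neg_imp_pos {y y' : ℝ → ℝ} {a b : ℝ} (ha : 0 ≤ y a)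
    (hy : ∀ t ∈ Set.Icc a b, HasDerivWithinAt y (y' t) (Set.Icc a b) t)
    (hpos : ∀ t ∈ Set.Icc a b, y t < 0 → 0 < y' t) :
    ∀ t ∈ Set.Icc a b, 0 ≤ y t := by
  intro t ht
  refine le_of_forall_pos_le_add fun δ hδ => ?_
  have key := image_le_of_deriv_right_lt_deriv_boundary (f := fun s => -y s)
    (f' := fun s => -y' s) (a := a) (b := b) (B := fun _ => δ) (B' := fun _ => 0)
    (fun s hs => (hy s hs).neg.continuousWithinAt)
    (fun s hs => (hy s ⟨hs.1, hs.2.le⟩).neg.mono_of_mem_nhdsWithin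
      (Icc_mem_nhdsGE_of_mem hs))
    (by linarith) (fun s => hasDerivAt_const s δ)
    (fun s hs hsδ => neg_lt_zero.mpr (hpos s ⟨hs.1, hs.2.le⟩ (by linarith)))
  have := key ht
  linarith


/-- Sampled-data doubly robust CBF forward invariance with piecewise-constant
(zero-order-hold) control (relative degree 1): if on each sampling interval
`[t₀ + kT, t₀ + (k+1)T]` the system evolves under the constant input `u_k`
computed from an estimate `x̂_k` of the sampled state (error at most `ε`), the
disturbance is bounded by `γ`, and the robustified CBF inequality with margin
`v̄ = ε + T(Δ + Pγ)` holds at each `x̂_k`, then `h(x(t₀)) ≥ 0` implies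
`h(x(t)) ≥ 0` for all `t ≥ t₀`. -/
theorem sampled_data_doubly_robust_cbf_invariance
    (n q r : ℕ)
    (f : EuclideanSpace ℝ (Fin n) → EuclideanSpace ℝ (Fin n))
    (g : EuclideanSpace ℝ (Fin n) → (EuclideanSpace ℝ (Fin q) →L[ℝ] EuclideanSpace ℝ (Fin n)))
    (p : EuclideanSpace ℝ (Fin n) → (EuclideanSpace ℝ (Fin r) →L[ℝ] EuclideanSpace ℝ (Fin n)))
    (h : EuclideanSpace ℝ (Fin n) → ℝ) (hdiff : Differentiable ℝ h)
    (α : ℝ → ℝ) (Kα : NNReal) (hαLip : LipschitzWith Kα α)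
    (hαMono : StrictMono α) (hα0 : α 0 = 0)
    (lf lg lα : NNReal)
    (hLf : LipschitzWith lf (fun y => fderiv ℝ h y (f y)))
    (hLg : LipschitzWith lg (fun y => (fderiv ℝ h y).comp (g y)))
    (hLα : LipschitzWith lα (fun y => α (h y)))
    (Δ P Λ : ℝ) (hΔ : 0 ≤ Δ) (hP : 0 ≤ P) (hΛ : 0 ≤ Λ)
    (t₀ T : ℝ) (hT : 0 < T) (ε γ : ℝ)
    (x : ℝ → EuclideanSpace ℝ (Fin n))
    (d : ℝ → EuclideanSpace ℝ (Fin r))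
    (u : ℕ → EuclideanSpace ℝ (Fin q))
    (xh : ℕ → EuclideanSpace ℝ (Fin n))
    (hd : ∀ t, ‖d t‖ ≤ γ)
    (hfg : ∀ y, ∀ k : ℕ, ‖f y + g y (u k)‖ ≤ Δ)
    (hp : ∀ y, ‖p y‖ ≤ P)
    (hLp : ∀ y, ‖(fderiv ℝ h y).comp (p y)‖ ≤ Λ)
    (hxderiv : ∀ k : ℕ, ∀ t ∈ Set.Icc (t₀ + k * T) (t₀ + (k + 1) * T),
      HasDerivWithinAt x (f (x t) + g (x t) (u k) + p (x t) (d t))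
        (Set.Icc (t₀ + k * T) (t₀ + (k + 1) * T)) t)
    (hest : ∀ k : ℕ, ‖x (t₀ + k * T) - xh k‖ ≤ ε)
    (hcond : ∀ k : ℕ,
      fderiv ℝ h (xh k) (f (xh k)) + (fderiv ℝ h (xh k)).comp (g (xh k)) (u k)
        + α (h (xh k))
        - ((lf : ℝ) + (lg : ℝ) * ‖u k‖ + (lα : ℝ)) * (ε + T * (Δ + P * γ))
        - Λ * γ ≥ 0)
    (h0 : h (x t₀) ≥ 0) :
    ∀ t, t₀ ≤ t → h (x t) ≥ 0 := by
  have hγ : 0 ≤ γ := (norm_nonneg _).trans (hd t₀)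
  have step : ∀ k : ℕ, 0 ≤ h (x (t₀ + k * T)) →
      ∀ t ∈ Set.Icc (t₀ + k * T) (t₀ + (k + 1) * T), 0 ≤ h (x t) := by
    intro k hk
    refine nonneg_of_hasDerivWithinAt_of_neg_imp_pos hk
      (fun t ht => (hdiff (x t)).hasFDerivAt.comp_hasDerivWithinAt t (hxderiv k t ht)) ?_
    intro t ht hneg
    have hle : t₀ + k * T ≤ t₀ + (k + 1) * T := by linarith
    have hpd : ∀ s, ‖p (x s) (d s)‖ ≤ P * γ := fun s =>
      (p (x s)).le_of_opNorm_le_of_le (hp (x s)) (hd s)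
    have hmove : ‖x t - x (t₀ + k * T)‖ ≤ (Δ + P * γ) * ‖t - (t₀ + k * T)‖ :=
      (convex_Icc _ _).norm_image_sub_le_of_norm_hasDerivWithin_le (hxderiv k)
        (fun s _ => (norm_add_le _ _).trans (add_le_add (hfg (x s) k) (hpd s)))
        (Set.left_mem_Icc.mpr hle) ht
    have htime : ‖t - (t₀ + k * T)‖ ≤ T := by
      rw [Real.norm_of_nonneg (by linarith [ht.1])]
      linarith [ht.2]
    have hdist : dist (x t) (xh k) ≤ ε + T * (Δ + P * γ) := by
      have h1 : dist (x t) (xh k) ≤ ‖x t - x (t₀ + k * T)‖ + ‖x (t₀ + k * T) - xh k‖ := by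
        simpa only [dist_eq_norm] using dist_triangle (x t) (x (t₀ + k * T)) (xh k)
      have h2 := mul_le_mul_of_nonneg_left htime (by positivity : 0 ≤ Δ + P * γ)
      linarith [hest k]
    have hf := (hLf.dist_le_mul (x t) (xh k)).trans
      (mul_le_mul_of_nonneg_left hdist lf.coe_nonneg)
    have hα := (hLα.dist_le_mul (x t) (xh k)).trans
      (mul_le_mul_of_nonneg_left hdist lα.coe_nonneg)
    have hg := (hLg.dist_le_mul (x t) (xh k)).trans
      (mul_le_mul_of_nonneg_left hdist lg.coe_nonneg)
    rw [dist_eq_norm] at hg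
    have hgu := ContinuousLinearMap.le_of_opNorm_le _ hg (u k)
    have hpΛ := ContinuousLinearMap.le_of_opNorm_le_of_le _ (hLp (x t)) (hd t)
    rw [Real.dist_eq] at hf hα
    rw [Real.norm_eq_abs] at hgu hpΛ
    have hf' := (abs_le.mp hf).1
    have hα' := (abs_le.mp hα).1
    have hgu' := (abs_le.mp hgu).1
    have hpΛ' := (abs_le.mp hpΛ).1
    have hαneg : α (h (x t)) < 0 := hα0 ▸ hαMono hneg
    have hc := hcond k
    simp only [sub_apply, ContinuousLinearMap.comp_apply] at hgu' hpΛ' hc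
    simp only [map_add]
    linarith
  have hsample : ∀ k : ℕ, 0 ≤ h (x (t₀ + k * T)) := by
    intro k
    induction k with
    | zero => simpa using h0
    | succ k ih =>
      have := step k ih _ (Set.right_mem_Icc.mpr (by linarith))
      simpa using this
  intro t ht
  have hquot : 0 ≤ (t - t₀) / T := div_nonneg (sub_nonneg.mpr ht) hT.le
  refine step ⌊(t - t₀) / T⌋₊ (hsample _) t ⟨?_, ?_⟩
  · have := (le_div_iff₀ hT).mp (Nat.floor_le hquot)
    linarith
  · have := (div_lt_iff₀ hT).mp (Nat.lt_floor_add_one ((t - t₀) / T))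
    linarith
end

section
/- (High-order doubly robust CBF forward invariance, continuous time, matched disturbance.) Let m ≥ 1 and let α₁, …, α_m : ℝ → ℝ each be Lipschitz, strictly monotone increasing with α_i(0) = 0. Let ψ₀ := h : E → ℝ and suppose that for i = 1, …, m−1 the functions ψ_i : E → ℝ defined by ψ_i(y) := Dψ_{i−1}(y)(f(y)) + α_i(ψ_{i−1}(y)) are well defined and differentiable, and that the relative-degree conditions hold: Dψ_{i−1}(y)(g(y)u) = 0 and Dψ_{i−1}(y)(p(y)d) = 0 for all y ∈ E, all inputs u, all disturbances d, and all i = 1, …, m−1. Assume y ↦ Dψ_{m−1}(y)(f(y)) is Lipschitz with constant l_f, y ↦ Dψ_{m−1}(y) ∘ g(y) is Lipschitz with constant l_g in operator norm, and α_m ∘ ψ_{m−1} is Lipschitz with constant l_α. Let t₀ ∈ ℝ and let x : ℝ → E, u : ℝ → EuclideanSpace ℝ (Fin q), d : ℝ → EuclideanSpace ℝ (Fin v), x̂ : ℝ → E satisfy, for all t ≥ t₀: x'(t) = f(x(t)) + g(x(t)) u(t) + p(x(t)) d(t), ‖d(t)‖ ≤ γ, ‖x(t) − x̂(t)‖ ≤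 ε, and Dψ_{m−1}(x̂(t))(f(x̂(t))) + Dψ_{m−1}(x̂(t))(g(x̂(t)) u(t)) + α_m(ψ_{m−1}(x̂(t))) − (l_f + l_g·‖u(t)‖ + l_α)·ε − ‖Dψ_{m−1}(x(t)) ∘ p(x(t))‖·γ ≥ 0. If ψ_i(x(t₀)) ≥ 0 for all i = 0, …, m−1, then ψ_i(x(t)) ≥ 0 for all t ≥ t₀ and all i = 0, …, m−1; in particular h(x(t)) ≥ 0 for all t ≥ t₀. -/
open Set in
/-- Nagumo-type invariance on a half-line: if `y' + a (y) ≥ 0` with `a` negative on the negative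
reals, then `y` stays nonnegative once it starts nonnegative. -/
theorem nonneg_of_hasDerivWithinAt_add_nonneg {a y y' : ℝ → ℝ} {t₀ : ℝ}
    (ha : ∀ s < 0, a s < 0)
    (hy : ∀ t, t₀ ≤ t → HasDerivWithinAt y (y' t) (Ici t₀) t)
    (hy' : ∀ t, t₀ ≤ t → 0 ≤ y' t + a (y t)) (h0 : 0 ≤ y t₀) {t : ℝ} (ht : t₀ ≤ t) :
    0 ≤ y t := by
  refine le_of_forall_pos_le_add fun δ hδ => ?_
  have key : -y t ≤ δ := by
    refine image_le_of_deriv_right_lt_deriv_boundary (f := fun s => -y s) (f' := fun s => -y' s)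
      (a := t₀) (b := t) (B := fun _ => δ) (B' := fun _ => 0) ?_ ?_ ?_ ?_ ?_
      (right_mem_Icc.2 ht)
    · exact fun s hs => ((hy s hs.1).continuousWithinAt.mono Icc_subset_Ici_self).neg
    · exact fun s hs => ((hy s hs.1).mono (Ici_subset_Ici.2 hs.1)).neg
    · linarith
    · exact fun s => hasDerivAt_const s δ
    · intro s hs hsδ
      have hys : y s < 0 := by linarith
      linarith [ha _ hys, hy' s hs.1]
  linarith


/-- High-order doubly robust CBF forward invariance (continuous time, matched
disturbance): with the HOCBF chain `ψ₀ = h`, `ψ_i = Dψ_{i−1}(f) + α_i(ψ_{i−1})`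
for `i = 1, …, m−1`, relative-degree conditions `Dψ_{i−1}(g u) = 0` and
`Dψ_{i−1}(p d) = 0` for `i = 1, …, m−1`, Lipschitz bounds on the top-level Lie
derivatives, bounded disturbance `‖d(t)‖ ≤ γ`, bounded estimation error
`‖x(t) − x̂(t)‖ ≤ ε`, and the robustified HOCBF condition at the estimates, if
`ψ_i(x(t₀)) ≥ 0` for all `i < m` then `ψ_i(x(t)) ≥ 0` for all `t ≥ t₀` and `i < m`. -/
theorem high_order_doubly_robust_cbf_invariance
    (n q r : ℕ)
    (f : EuclideanSpace ℝ (Fin n) → EuclideanSpace ℝ (Fin n))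
    (g : EuclideanSpace ℝ (Fin n) → (EuclideanSpace ℝ (Fin q) →L[ℝ] EuclideanSpace ℝ (Fin n)))
    (p : EuclideanSpace ℝ (Fin n) → (EuclideanSpace ℝ (Fin r) →L[ℝ] EuclideanSpace ℝ (Fin n)))
    (m : ℕ) (hm : 1 ≤ m)
    (α : ℕ → ℝ → ℝ)
    (hαLip : ∀ i, 1 ≤ i → i ≤ m → ∃ K : NNReal, LipschitzWith K (α i))
    (hαMono : ∀ i, 1 ≤ i → i ≤ m → StrictMono (α i))
    (hα0 : ∀ i, 1 ≤ i → i ≤ m → α i 0 = 0)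
    (h : EuclideanSpace ℝ (Fin n) → ℝ)
    (ψ : ℕ → EuclideanSpace ℝ (Fin n) → ℝ)
    (hψ0 : ψ 0 = h)
    (hψdiff : ∀ i, i < m → Differentiable ℝ (ψ i))
    (hψdef : ∀ i, i + 1 < m → ∀ y,
      ψ (i + 1) y = fderiv ℝ (ψ i) y (f y) + α (i + 1) (ψ i y))
    (hrelg : ∀ i, i + 1 < m → ∀ y, ∀ uu : EuclideanSpace ℝ (Fin q),
      fderiv ℝ (ψ i) y (g y uu) = 0)
    (hrelp : ∀ i, i + 1 < m → ∀ y, ∀ dd : EuclideanSpace ℝ (Fin r),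
      fderiv ℝ (ψ i) y (p y dd) = 0)
    (lf lg lα : NNReal)
    (hLf : LipschitzWith lf (fun y => fderiv ℝ (ψ (m - 1)) y (f y)))
    (hLg : LipschitzWith lg (fun y => (fderiv ℝ (ψ (m - 1)) y).comp (g y)))
    (hLα : LipschitzWith lα (fun y => α m (ψ (m - 1) y)))
    (t₀ : ℝ) (ε γ : ℝ)
    (x xh : ℝ → EuclideanSpace ℝ (Fin n))
    (u : ℝ → EuclideanSpace ℝ (Fin q))
    (d : ℝ → EuclideanSpace ℝ (Fin r))
    (hxderiv : ∀ t, t₀ ≤ t →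
      HasDerivWithinAt x (f (x t) + g (x t) (u t) + p (x t) (d t)) (Set.Ici t₀) t)
    (hd : ∀ t, t₀ ≤ t → ‖d t‖ ≤ γ)
    (hest : ∀ t, t₀ ≤ t → ‖x t - xh t‖ ≤ ε)
    (hcond : ∀ t, t₀ ≤ t →
      fderiv ℝ (ψ (m - 1)) (xh t) (f (xh t))
        + fderiv ℝ (ψ (m - 1)) (xh t) (g (xh t) (u t))
        + α m (ψ (m - 1) (xh t))
        - ((lf : ℝ) + (lg : ℝ) * ‖u t‖ + (lα : ℝ)) * ε
        - ‖(fderiv ℝ (ψ (m - 1)) (x t)).comp (p (x t))‖ * γ ≥ 0)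
    (h0 : ∀ i, i < m → ψ i (x t₀) ≥ 0) :
    ∀ i, i < m → ∀ t, t₀ ≤ t → ψ i (x t) ≥ 0 := by
  have hneg : ∀ i, 1 ≤ i → i ≤ m → ∀ s < 0, α i s < 0 := fun i hi him s hs => by
    simpa [hα0 i hi him] using hαMono i hi him hs
  have hderiv : ∀ i, i < m → ∀ t, t₀ ≤ t → HasDerivWithinAt (fun s => ψ i (x s))
      (fderiv ℝ (ψ i) (x t) (f (x t) + g (x t) (u t) + p (x t) (d t))) (Set.Ici t₀) t :=
    fun i hi t ht =>
      (hψdiff i hi (x t)).hasFDerivAt.comp_hasDerivWithinAt t (hxderiv t ht)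
  have htop : ∀ t, t₀ ≤ t → 0 ≤ fderiv ℝ (ψ (m - 1)) (x t)
      (f (x t) + g (x t) (u t) + p (x t) (d t)) + α m (ψ (m - 1) (x t)) := by
    intro t ht
    have hc := hcond t ht
    have hdist : dist (x t) (xh t) ≤ ε := by simpa [dist_eq_norm] using hest t ht
    have hF := (hLf.dist_le_mul (x t) (xh t)).trans
      (mul_le_mul_of_nonneg_left hdist lf.coe_nonneg)
    have hA := (hLα.dist_le_mul (x t) (xh t)).trans
      (mul_le_mul_of_nonneg_left hdist lα.coe_nonneg)
    have hG := (hLg.dist_le_mul (x t) (xh t)).trans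
      (mul_le_mul_of_nonneg_left hdist lg.coe_nonneg)
    rw [dist_eq_norm] at hG
    have hGu := ContinuousLinearMap.le_of_opNorm_le _ hG (u t)
    have hPd := ((fderiv ℝ (ψ (m - 1)) (x t)).comp (p (x t))).le_opNorm_of_le (hd t ht)
    rw [Real.dist_eq] at hF hA
    simp only [sub_apply, ContinuousLinearMap.comp_apply, Real.norm_eq_abs] at hGu hPd
    have hF' := (abs_le.1 hF).1
    have hA' := (abs_le.1 hA).1
    have hGu' := (abs_le.1 hGu).1
    have hPd' := (abs_le.1 hPd).1
    rw [map_add, map_add]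
    linarith
  have hdown : ∀ k i, i + k + 1 = m → ∀ t, t₀ ≤ t → 0 ≤ ψ i (x t) := by
    intro k
    induction k with
    | zero =>
      intro i hi t ht
      obtain rfl : i = m - 1 := by omega
      exact nonneg_of_hasDerivWithinAt_add_nonneg (hneg m hm le_rfl)
        (hderiv _ (by omega)) htop (h0 _ (by omega)) ht
    | succ k ih =>
      intro i hi t ht
      refine nonneg_of_hasDerivWithinAt_add_nonneg (hneg (i + 1) (by omega) (by omega))
        (hderiv i (by omega)) (fun s hs => ?_) (h0 i (by omega)) ht
      have hnext := ih (i + 1) (by omega) s hs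
      rw [hψdef i (by omega)] at hnext
      rwa [map_add, map_add, hrelg i (by omega), hrelp i (by omega), add_zero, add_zero]
  exact fun i hi t ht => hdown (m - 1 - i) i (by omega) t ht
end

section
/- (High-order doubly robust CBF forward invariance for sampled-data systems, matched disturbance.) Let m ≥ 1 and α₁, …, α_m : ℝ → ℝ each be Lipschitz, strictly monotone increasing with α_i(0) = 0. Let ψ₀ := h : E → ℝ, and for i = 1, …, m−1 let ψ_i(y) := Dψ_{i−1}(y)(f(y)) + α_i(ψ_{i−1}(y)) be well defined and differentiable, with the relative-degree conditions Dψ_{i−1}(y)(g(y)u) = 0 and Dψ_{i−1}(y)(p(y)d) = 0 for all y, u, d and i = 1, …, m−1. Assume y ↦ Dψ_{m−1}(y)(f(y)) is Lipschitz with constant l_f, y ↦ Dψ_{m−1}(y) ∘ g(y) is Lipschitz with constant l_g in operator norm, α_m ∘ ψ_{m−1} is Lipschitz with constant l_α, and there exist Δ, P, Λ ≥ 0 with ‖f(y) + g(y)u‖ ≤ Δ for every applied input u, ‖p(y)‖ ≤ P, and ‖Dψ_{m−1}(y) ∘ p(y)‖ ≤ Λ for all y ∈ E. Fix t₀ ∈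 ℝ, T > 0, t_k := t₀ + kT, and set v̄ := ε + T(Δ + Pγ). Let x : ℝ → E and d with ‖d(t)‖ ≤ γ, and for each k ∈ ℕ let u_k and x̂_k satisfy: x'(t) = f(x(t)) + g(x(t)) u_k + p(x(t)) d(t) for t ∈ [t_k, t_{k+1}], ‖x(t_k) − x̂_k‖ ≤ ε, and Dψ_{m−1}(x̂_k)(f(x̂_k)) + Dψ_{m−1}(x̂_k)(g(x̂_k) u_k) + α_m(ψ_{m−1}(x̂_k)) − (l_f + l_g·‖u_k‖ + l_α)·v̄ − Λ·γ ≥ 0. If ψ_i(x(t₀)) ≥ 0 for all i = 0, …, m−1, then ψ_i(x(t)) ≥ 0 for all t ≥ t₀ and all i = 0, …, m−1; in particular h(x(t)) ≥ 0 for all t ≥ t₀. -/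
open Set in
/-- A function on `[a, b]` that starts nonnegative and has nonnegative derivative wherever it is
negative stays nonnegative. -/
theorem nonneg_of_deriv_nonneg_of_neg {φ φ' : ℝ → ℝ} {a b : ℝ}
    (hφ : ∀ t ∈ Icc a b, HasDerivWithinAt φ (φ' t) (Icc a b) t) (ha : 0 ≤ φ a)
    (hneg : ∀ t ∈ Icc a b, φ t < 0 → 0 ≤ φ' t) :
    ∀ t ∈ Icc a b, 0 ≤ φ t := by
  intro t ht
  have bound : ∀ δ > 0, -φ t ≤ δ * (1 + (t - a)) := by
    intro δ hδ
    refine image_le_of_deriv_right_lt_deriv_boundary (f := fun s => -φ s) (f' := fun s => -φ' s)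
      (B := fun s => δ * (1 + (s - a))) (B' := fun _ => δ)
      (fun s hs => (hφ s hs).continuousWithinAt.neg)
      (fun s hs => ((hφ s (Ico_subset_Icc_self hs)).mono_of_mem_nhdsWithin
        (Icc_mem_nhdsGE_of_mem hs)).neg)
      (by simp only [sub_self]; linarith) (fun s => ?_) (fun s hs hs' => ?_) ht
    · simpa using (((hasDerivAt_id s).sub_const a).const_add 1).const_mul δ
    · have : 0 < δ * (1 + (s - a)) := mul_pos hδ (by linarith [hs.1])
      have := hneg s (Ico_subset_Icc_self hs) (by linarith)
      linarith
  by_contra! hlt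
  have hpos : 0 < 2 * (1 + (t - a)) := by linarith [ht.1]
  have := bound (-φ t / (2 * (1 + (t - a)))) (div_pos (by linarith) hpos)
  rw [div_mul_eq_mul_div, le_div_iff₀ hpos] at this
  nlinarith [ht.1, mul_pos (neg_pos.2 hlt) hpos]


/-- High-order doubly robust CBF forward invariance for sampled-data systems
(matched disturbance): with the HOCBF chain `ψ₀ = h`, `ψ_i = Dψ_{i−1}(f) + α_i(ψ_{i−1})`
and matched relative-degree conditions, zero-order-hold inputs `u_k` held on
`[t_k, t_{k+1}]` (`t_k = t₀ + kT`) computed from estimates `x̂_k` with error at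
most `ε`, disturbance bounded by `γ`, and the robustified HOCBF condition with
margin `v̄ = ε + T(Δ + Pγ)` at each `x̂_k`, if `ψ_i(x(t₀)) ≥ 0` for all `i < m`
then `ψ_i(x(t)) ≥ 0` for all `t ≥ t₀` and `i < m`. -/
theorem high_order_sampled_data_doubly_robust_cbf_invariance
    (n q r : ℕ)
    (f : EuclideanSpace ℝ (Fin n) → EuclideanSpace ℝ (Fin n))
    (g : EuclideanSpace ℝ (Fin n) → (EuclideanSpace ℝ (Fin q) →L[ℝ] EuclideanSpace ℝ (Fin n)))
    (p : EuclideanSpace ℝ (Fin n) → (EuclideanSpace ℝ (Fin r) →L[ℝ] EuclideanSpace ℝ (Fin n)))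
    (m : ℕ) (hm : 1 ≤ m)
    (α : ℕ → ℝ → ℝ)
    (hαLip : ∀ i, 1 ≤ i → i ≤ m → ∃ K : NNReal, LipschitzWith K (α i))
    (hαMono : ∀ i, 1 ≤ i → i ≤ m → StrictMono (α i))
    (hα0 : ∀ i, 1 ≤ i → i ≤ m → α i 0 = 0)
    (h : EuclideanSpace ℝ (Fin n) → ℝ)
    (ψ : ℕ → EuclideanSpace ℝ (Fin n) → ℝ)
    (hψ0 : ψ 0 = h)
    (hψdiff : ∀ i, i < m → Differentiable ℝ (ψ i))
    (hψdef : ∀ i, i + 1 < m → ∀ y,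
      ψ (i + 1) y = fderiv ℝ (ψ i) y (f y) + α (i + 1) (ψ i y))
    (hrelg : ∀ i, i + 1 < m → ∀ y, ∀ uu : EuclideanSpace ℝ (Fin q),
      fderiv ℝ (ψ i) y (g y uu) = 0)
    (hrelp : ∀ i, i + 1 < m → ∀ y, ∀ dd : EuclideanSpace ℝ (Fin r),
      fderiv ℝ (ψ i) y (p y dd) = 0)
    (lf lg lα : NNReal)
    (hLf : LipschitzWith lf (fun y => fderiv ℝ (ψ (m - 1)) y (f y)))
    (hLg : LipschitzWith lg (fun y => (fderiv ℝ (ψ (m - 1)) y).comp (g y)))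
    (hLα : LipschitzWith lα (fun y => α m (ψ (m - 1) y)))
    (Δ P Λ : ℝ) (hΔ : 0 ≤ Δ) (hP : 0 ≤ P) (hΛ : 0 ≤ Λ)
    (t₀ T : ℝ) (hT : 0 < T) (ε γ : ℝ)
    (x : ℝ → EuclideanSpace ℝ (Fin n))
    (d : ℝ → EuclideanSpace ℝ (Fin r))
    (u : ℕ → EuclideanSpace ℝ (Fin q))
    (xh : ℕ → EuclideanSpace ℝ (Fin n))
    (hd : ∀ t, ‖d t‖ ≤ γ)
    (hfg : ∀ y, ∀ k : ℕ, ‖f y + g y (u k)‖ ≤ Δ)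
    (hp : ∀ y, ‖p y‖ ≤ P)
    (hLp : ∀ y, ‖(fderiv ℝ (ψ (m - 1)) y).comp (p y)‖ ≤ Λ)
    (hxderiv : ∀ k : ℕ, ∀ t ∈ Set.Icc (t₀ + k * T) (t₀ + (k + 1) * T),
      HasDerivWithinAt x (f (x t) + g (x t) (u k) + p (x t) (d t))
        (Set.Icc (t₀ + k * T) (t₀ + (k + 1) * T)) t)
    (hest : ∀ k : ℕ, ‖x (t₀ + k * T) - xh k‖ ≤ ε)
    (hcond : ∀ k : ℕ,
      fderiv ℝ (ψ (m - 1)) (xh k) (f (xh k))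
        + fderiv ℝ (ψ (m - 1)) (xh k) (g (xh k) (u k))
        + α m (ψ (m - 1) (xh k))
        - ((lf : ℝ) + (lg : ℝ) * ‖u k‖ + (lα : ℝ)) * (ε + T * (Δ + P * γ))
        - Λ * γ ≥ 0)
    (h0 : ∀ i, i < m → ψ i (x t₀) ≥ 0) :
    ∀ i, i < m → ∀ t, t₀ ≤ t → ψ i (x t) ≥ 0 := by
  have hγ : 0 ≤ γ := (norm_nonneg _).trans (hd 0)
  have hPd : ∀ y t, ‖p y (d t)‖ ≤ P * γ := fun y t =>
    (p y).le_of_opNorm_le_of_le (hp y) (hd t)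
  have hdev : ∀ k : ℕ, ∀ t ∈ Set.Icc (t₀ + k * T) (t₀ + (k + 1) * T),
      ‖x t - xh k‖ ≤ ε + T * (Δ + P * γ) := by
    intro k t ht
    have hmem : t₀ + k * T ∈ Set.Icc (t₀ + k * T) (t₀ + (k + 1) * T) :=
      ⟨le_rfl, by linarith⟩
    have hmv := (convex_Icc (t₀ + k * T) (t₀ + (k + 1) * T)).norm_image_sub_le_of_norm_hasDerivWithin_le
      (C := Δ + P * γ) (hxderiv k)
      (fun s _ => (norm_add_le _ _).trans (add_le_add (hfg _ k) (hPd _ s))) hmem ht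
    have hlen : ‖t - (t₀ + k * T)‖ ≤ T := by
      rw [Real.norm_of_nonneg (by linarith [ht.1])]
      linarith [ht.2]
    have hC : 0 ≤ Δ + P * γ := by positivity
    have htri := norm_sub_le_norm_sub_add_norm_sub (x t) (x (t₀ + k * T)) (xh k)
    nlinarith [hest k, mul_le_mul_of_nonneg_left hlen hC]
  have hchain : ∀ i, i < m → ∀ k : ℕ, ∀ t ∈ Set.Icc (t₀ + k * T) (t₀ + (k + 1) * T),
      HasDerivWithinAt (fun s => ψ i (x s))
        (fderiv ℝ (ψ i) (x t) (f (x t) + g (x t) (u k) + p (x t) (d t)))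
        (Set.Icc (t₀ + k * T) (t₀ + (k + 1) * T)) t := fun i hi k t ht =>
    (hψdiff i hi (x t)).hasFDerivAt.comp_hasDerivWithinAt t (hxderiv k t ht)
  have hαneg : ∀ i, i < m → ∀ z < 0, α (i + 1) z ≤ 0 := fun i hi z hz =>
    ((hαMono (i + 1) (by omega) hi hz).le).trans_eq (hα0 (i + 1) (by omega) hi)
  have htop : ∀ k : ℕ, ∀ t ∈ Set.Icc (t₀ + k * T) (t₀ + (k + 1) * T),
      0 ≤ fderiv ℝ (ψ (m - 1)) (x t) (f (x t) + g (x t) (u k) + p (x t) (d t))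
        + α m (ψ (m - 1) (x t)) := by
    intro k t ht
    set v := ε + T * (Δ + P * γ)
    have hv := hdev k t ht
    have h1 := (hLf.norm_sub_le (x t) (xh k)).trans (mul_le_mul_of_nonneg_left hv lf.coe_nonneg)
    have h2 := (hLα.norm_sub_le (x t) (xh k)).trans (mul_le_mul_of_nonneg_left hv lα.coe_nonneg)
    have h3 := ContinuousLinearMap.le_of_opNorm_le _
      ((hLg.norm_sub_le (x t) (xh k)).trans (mul_le_mul_of_nonneg_left hv lg.coe_nonneg)) (u k)
    have h4 := ((fderiv ℝ (ψ (m - 1)) (x t)).comp (p (x t))).le_of_opNorm_le_of_le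
      (hLp (x t)) (hd t)
    simp only [sub_apply, ContinuousLinearMap.comp_apply,
      Real.norm_eq_abs] at h1 h2 h3 h4
    simp only [map_add]
    linarith [hcond k, (abs_le.1 h1).1, (abs_le.1 h2).1, (abs_le.1 h3).1, (abs_le.1 h4).1]
  have hstep : ∀ k : ℕ, (∀ i, i < m → 0 ≤ ψ i (x (t₀ + k * T))) → ∀ i, i < m →
      ∀ t ∈ Set.Icc (t₀ + k * T) (t₀ + (k + 1) * T), 0 ≤ ψ i (x t) := by
    intro k hk i hi
    induction Nat.le_sub_one_of_lt hi using Nat.decreasingInduction with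
    | self =>
      refine nonneg_of_deriv_nonneg_of_neg (hchain _ hi k) (hk _ hi) fun t ht hlt => ?_
      have := hαneg _ hi _ hlt
      rw [Nat.sub_add_cancel hm] at this
      linarith [htop k t ht]
    | of_succ j hj ih =>
      have hj' : j + 1 < m := by omega
      refine nonneg_of_deriv_nonneg_of_neg (hchain _ hi k) (hk _ hi) fun t ht hlt => ?_
      rw [map_add, map_add, hrelg j hj', hrelp j hj']
      linarith [hαneg _ hi _ hlt, hψdef j hj' (x t), ih hj' t ht]
  have hnode : ∀ k : ℕ, ∀ i, i < m → 0 ≤ ψ i (x (t₀ + k * T)) := by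
    intro k
    induction k with
    | zero => simpa using h0
    | succ k ih =>
      intro i hi
      push_cast
      exact hstep k ih i hi _ ⟨by linarith, le_rfl⟩
  intro i hi t ht
  have hdiv : 0 ≤ (t - t₀) / T := div_nonneg (by linarith) hT.le
  refine hstep ⌊(t - t₀) / T⌋₊ (hnode _) i hi t ⟨?_, ?_⟩
  · have := (le_div_iff₀ hT).1 (Nat.floor_le hdiv)
    linarith
  · have := (div_lt_iff₀ hT).1 (Nat.lt_floor_add_one ((t - t₀) / T))
    linarith
end

section
/- (Reachable-set margin guarantees safety over a sampling interval.) Let ψ : E → ℝ be differentiable and α : ℝ → ℝ be Lipschitz, strictly monotone increasing with α(0) = 0. Let t_k ∈ ℝ, T > 0, u_k ∈ EuclideanSpace ℝ (Fin q), x̂_k ∈ E, and let R ⊆ E. Let x : ℝ → E satisfy x'(t) = f(x(t)) + g(x(t)) u_k + p(x(t)) d(t) with ‖d(t)‖ ≤ γ and x(t) ∈ R for all t ∈ [t_k, t_k + T]. Suppose the over-approximated worst-case condition holds: for every y ∈ R and every disturbance d with ‖d‖ ≤ γ, [L_f ψ(x̂_k) + (L_g ψ(x̂_k))(u_k) + α(ψ(x̂_k))]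 + [(L_f ψ(y) − L_f ψ(x̂_k)) + (L_g ψ(y) − L_g ψ(x̂_k))(u_k) + (L_p ψ(y))(d) + (α(ψ(y)) − α(ψ(x̂_k)))] ≥ 0. Then (d/dt)ψ(x(t)) + α(ψ(x(t))) ≥ 0 for all t ∈ [t_k, t_k + T]; consequently, if ψ(x(t_k)) ≥ 0 then ψ(x(t)) ≥ 0 for all t ∈ [t_k, t_k + T]. -/
/-- A function on `[a, b]` that is nonnegative at `a` and whose derivative is positive wherever it
is negative stays nonnegative. -/
theorem nonneg_of_hasDerivWithinAt_pos_of_neg {a b : ℝ} {h h' : ℝ → ℝ}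
    (hderiv : ∀ t ∈ Set.Icc a b, HasDerivWithinAt h (h' t) (Set.Icc a b) t)
    (hpos : ∀ t ∈ Set.Icc a b, h t < 0 → 0 < h' t) (ha : 0 ≤ h a) :
    ∀ t ∈ Set.Icc a b, 0 ≤ h t := by
  intro t ht
  have hab : a ≤ b := ht.1.trans ht.2
  obtain ⟨m, hm, hmin⟩ := isCompact_Icc.exists_isMinOn ⟨t, ht⟩
    fun s hs => (hderiv s hs).continuousWithinAt
  refine le_trans ?_ (hmin ht)
  by_contra! hneg
  have ham : a < m := lt_of_le_of_ne hm.1 (by rintro rfl; exact hneg.not_ge ha)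
  have hcone : a - m ∈ posTangentConeAt (Set.Icc a b) m :=
    sub_mem_posTangentConeAt_of_segment_subset
      ((convex_Icc a b).segment_subset hm (Set.left_mem_Icc.2 hab))
  have hslope := hmin.localize.hasFDerivWithinAt_nonneg
    (hderiv m hm).hasFDerivWithinAt hcone
  simp only [ContinuousLinearMap.toSpanSingleton_apply, smul_eq_mul] at hslope
  nlinarith [hpos m hm hneg]

/-- Reachable-set margin guarantees safety over a sampling interval: if the
trajectory stays in the over-approximation `R` of the reachable set and the
nominal CBF value at the sampled estimate `x̂_k` dominates the worst-case margin
over `R` and all admissible disturbances, then `(d/dt)ψ(x(t)) + α(ψ(x(t))) ≥ 0`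
on `[t_k, t_k + T]`; consequently `ψ(x(t_k)) ≥ 0` implies `ψ(x(t)) ≥ 0` there. -/
theorem reachable_set_margin_safety
    (n q r : ℕ)
    (f : EuclideanSpace ℝ (Fin n) → EuclideanSpace ℝ (Fin n))
    (g : EuclideanSpace ℝ (Fin n) → (EuclideanSpace ℝ (Fin q) →L[ℝ] EuclideanSpace ℝ (Fin n)))
    (p : EuclideanSpace ℝ (Fin n) → (EuclideanSpace ℝ (Fin r) →L[ℝ] EuclideanSpace ℝ (Fin n)))
    (ψ : EuclideanSpace ℝ (Fin n) → ℝ) (hψdiff : Differentiable ℝ ψ)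
    (α : ℝ → ℝ) (Kα : NNReal) (hαLip : LipschitzWith Kα α)
    (hαMono : StrictMono α) (hα0 : α 0 = 0)
    (tk T : ℝ) (hT : 0 < T)
    (uk : EuclideanSpace ℝ (Fin q))
    (xhk : EuclideanSpace ℝ (Fin n))
    (R : Set (EuclideanSpace ℝ (Fin n)))
    (x : ℝ → EuclideanSpace ℝ (Fin n))
    (d : ℝ → EuclideanSpace ℝ (Fin r)) (γ : ℝ)
    (hxderiv : ∀ t ∈ Set.Icc tk (tk + T),
      HasDerivWithinAt x (f (x t) + g (x t) uk + p (x t) (d t)) (Set.Icc tk (tk + T)) t)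
    (hd : ∀ t ∈ Set.Icc tk (tk + T), ‖d t‖ ≤ γ)
    (hxR : ∀ t ∈ Set.Icc tk (tk + T), x t ∈ R)
    (hcond : ∀ y ∈ R, ∀ dd : EuclideanSpace ℝ (Fin r), ‖dd‖ ≤ γ →
      (fderiv ℝ ψ xhk (f xhk) + (fderiv ℝ ψ xhk).comp (g xhk) uk + α (ψ xhk))
        + ((fderiv ℝ ψ y (f y) - fderiv ℝ ψ xhk (f xhk))
          + ((fderiv ℝ ψ y).comp (g y) uk - (fderiv ℝ ψ xhk).comp (g xhk) uk)
          + (fderiv ℝ ψ y).comp (p y) dd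
          + (α (ψ y) - α (ψ xhk))) ≥ 0) :
    (∀ t ∈ Set.Icc tk (tk + T),
      derivWithin (fun s => ψ (x s)) (Set.Icc tk (tk + T)) t + α (ψ (x t)) ≥ 0) ∧
    (ψ (x tk) ≥ 0 → ∀ t ∈ Set.Icc tk (tk + T), ψ (x t) ≥ 0) := by
  have hderiv : ∀ t ∈ Set.Icc tk (tk + T), HasDerivWithinAt (fun s => ψ (x s))
      (fderiv ℝ ψ (x t) (f (x t) + g (x t) uk + p (x t) (d t))) (Set.Icc tk (tk + T)) t :=
    fun t ht => (hψdiff (x t)).hasFDerivAt.comp_hasDerivWithinAt t (hxderiv t ht)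
  have hbarrier : ∀ t ∈ Set.Icc tk (tk + T),
      0 ≤ fderiv ℝ ψ (x t) (f (x t) + g (x t) uk + p (x t) (d t)) + α (ψ (x t)) := by
    intro t ht
    have h := hcond (x t) (hxR t ht) (d t) (hd t ht)
    simp only [ContinuousLinearMap.comp_apply] at h
    simp only [map_add]
    linarith
  refine ⟨fun t ht => ?_, nonneg_of_hasDerivWithinAt_pos_of_neg hderiv fun t ht hneg => ?_⟩
  · rw [(hderiv t ht).derivWithin (uniqueDiffOn_Icc (by linarith) t ht)]
    exact hbarrier t ht
  · have hα : α (ψ (x t)) < 0 := hα0 ▸ hαMono hneg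
    linarith [hbarrier t ht]
end

section
/- (Sampled-data CBF with exponential margin guarantees safety over a sampling interval.) Let h : E → ℝ be differentiable and α : ℝ → ℝ be Lipschitz, strictly monotone increasing with α(0) = 0. Assume y ↦ L_f h(y) is Lipschitz with constant l_{L_f h}, y ↦ L_g h(y) is Lipschitz with constant l_{L_g h} in operator norm, and α ∘ h is Lipschitz with constant l_{α∘h}. Let t_k ∈ ℝ, T > 0, and let x : ℝ → E satisfy, for all t ∈ [t_k, t_k + T], x'(t) = f(x(t)) + g(x(t)) u_k for a fixed input u_k with ‖u_k‖ ≤ u_max. Assume ‖f(y) + g(y) u_k‖ ≤ Δ for all y ∈ E, and set l₁ := (l_{L_f h} + l_{L_g h}·u_max + l_{α∘h})·Δ and l₂ := l_{L_f h} + l_{L_g h}·u_max, with l₂ > 0. If L_f h(x(t_k)) + (L_g h(x(t_k)))(u_k) + α(h(x(t_k))) − (l₁/l₂)(e^{l₂ T} − 1) ≥ 0, then (d/dt)h(x(t)) + α(h(x(t))) ≥ 0 for all t ∈ [t_k, t_k + T]; consequently, if h(x(t_k)) ≥ 0 then h(x(t)) ≥ 0 for all t ∈ [t_k, t_k + T].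 -/
/-- If the derivative of `y` is at least `-α(y)` on `[a, b]`, with `α` negative on the negative
reals, then the nonnegative half-line is forward invariant for `y`. -/
theorem nonneg_of_deriv_add_nonneg {α y y' : ℝ → ℝ} {a b : ℝ}
    (hα : ∀ r < 0, α r < 0)
    (hy : ∀ t ∈ Set.Icc a b, HasDerivWithinAt y (y' t) (Set.Icc a b) t)
    (hbound : ∀ t ∈ Set.Icc a b, 0 ≤ y' t + α (y t)) (ha : 0 ≤ y a) :
    ∀ t ∈ Set.Icc a b, 0 ≤ y t := by
  intro t ht
  refine le_of_forall_pos_le_add fun ε hε => ?_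
  have key : -y t ≤ ε := by
    refine image_le_of_deriv_right_lt_deriv_boundary (f := fun s => -y s) (f' := fun s => -y' s)
      (B := fun _ => ε) (B' := fun _ => 0)
      (fun s hs => (hy s hs).continuousWithinAt.neg) ?_ (by linarith)
      (fun s => hasDerivAt_const s ε) ?_ ht
    · intro s hs
      exact ((hy s (Set.Ico_subset_Icc_self hs)).mono_of_mem_nhdsWithin
        (Icc_mem_nhdsGE_of_mem hs)).neg
    · intro s hs hsε
      have h_bound := hbound s (Set.Ico_subset_Icc_self hs)
      have h_neg := hα (y s) (by linarith)
      linarith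
  linarith

/-- Evaluation at a vector of norm at most `c` turns a Lipschitz operator-valued map into a
`K * c`-Lipschitz vector-valued map. -/
theorem LipschitzWith.norm_clm_apply_sub_le {X V W : Type*} [SeminormedAddCommGroup X]
    [SeminormedAddCommGroup V] [NormedSpace ℝ V] [SeminormedAddCommGroup W] [NormedSpace ℝ W]
    {K : NNReal} {A : X → V →L[ℝ] W} (hA : LipschitzWith K A) {v : V} {c : ℝ} (hv : ‖v‖ ≤ c)
    (p r : X) : ‖A p v - A r v‖ ≤ K * c * ‖p - r‖ := by
  calc ‖A p v - A r v‖ = ‖(A p - A r) v‖ := rfl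
    _ ≤ ‖A p - A r‖ * ‖v‖ := (A p - A r).le_opNorm v
    _ ≤ (K * ‖p - r‖) * c := by
      gcongr
      exact hA.norm_sub_le p r
    _ = K * c * ‖p - r‖ := by ring

/-- Sampled-data CBF with exponential margin guarantees safety over a sampling
interval: for the undisturbed system `ẋ = f(x) + g(x)u_k` under a zero-order-hold
input `u_k` with `‖u_k‖ ≤ u_max`, if the CBF inequality at the exactly measured
sampled state `x(t_k)` holds with the margin `(l₁/l₂)(e^{l₂T} − 1)`, where
`l₁ = (l_{L_f h} + l_{L_g h} u_max + l_{α∘h})Δ` and `l₂ = l_{L_f h} + l_{L_g h} u_max`,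
then `(d/dt)h(x(t)) + α(h(x(t))) ≥ 0` on `[t_k, t_k + T]`; consequently
`h(x(t_k)) ≥ 0` implies `h(x(t)) ≥ 0` there. -/
theorem sampled_data_cbf_exponential_margin
    (n q : ℕ)
    (f : EuclideanSpace ℝ (Fin n) → EuclideanSpace ℝ (Fin n))
    (g : EuclideanSpace ℝ (Fin n) → (EuclideanSpace ℝ (Fin q) →L[ℝ] EuclideanSpace ℝ (Fin n)))
    (h : EuclideanSpace ℝ (Fin n) → ℝ) (hdiff : Differentiable ℝ h)
    (α : ℝ → ℝ) (Kα : NNReal) (hαLip : LipschitzWith Kα α)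
    (hαMono : StrictMono α) (hα0 : α 0 = 0)
    (lf lg lα : NNReal)
    (hLf : LipschitzWith lf (fun y => fderiv ℝ h y (f y)))
    (hLg : LipschitzWith lg (fun y => (fderiv ℝ h y).comp (g y)))
    (hLα : LipschitzWith lα (fun y => α (h y)))
    (tk T : ℝ) (hT : 0 < T)
    (uk : EuclideanSpace ℝ (Fin q)) (umax : ℝ) (humax : ‖uk‖ ≤ umax)
    (x : ℝ → EuclideanSpace ℝ (Fin n))
    (hxderiv : ∀ t ∈ Set.Icc tk (tk + T),
      HasDerivWithinAt x (f (x t) + g (x t) uk) (Set.Icc tk (tk + T)) t)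
    (Δ : ℝ) (hfg : ∀ y, ‖f y + g y uk‖ ≤ Δ)
    (l₁ l₂ : ℝ)
    (hl₁ : l₁ = ((lf : ℝ) + (lg : ℝ) * umax + (lα : ℝ)) * Δ)
    (hl₂ : l₂ = (lf : ℝ) + (lg : ℝ) * umax)
    (hl₂pos : 0 < l₂)
    (hcond : fderiv ℝ h (x tk) (f (x tk)) + (fderiv ℝ h (x tk)).comp (g (x tk)) uk
      + α (h (x tk)) - (l₁ / l₂) * (Real.exp (l₂ * T) - 1) ≥ 0) :
    (∀ t ∈ Set.Icc tk (tk + T),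
      derivWithin (fun s => h (x s)) (Set.Icc tk (tk + T)) t + α (h (x t)) ≥ 0) ∧
    (h (x tk) ≥ 0 → ∀ t ∈ Set.Icc tk (tk + T), h (x t) ≥ 0) := by
  have hy : ∀ t ∈ Set.Icc tk (tk + T), HasDerivWithinAt (fun s => h (x s))
      (fderiv ℝ h (x t) (f (x t) + g (x t) uk)) (Set.Icc tk (tk + T)) t := fun t ht =>
    (hdiff (x t)).hasFDerivAt.comp_hasDerivWithinAt t (hxderiv t ht)
  have htk : tk ∈ Set.Icc tk (tk + T) := ⟨le_rfl, by linarith⟩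
  have hΔ : 0 ≤ Δ := (norm_nonneg _).trans (hfg (x tk))
  have hl₁nonneg : 0 ≤ l₁ := by
    rw [hl₁, ← hl₂]
    positivity
  have hmargin : l₁ * T ≤ l₁ / l₂ * (Real.exp (l₂ * T) - 1) := by
    calc l₁ * T = l₁ / l₂ * (l₂ * T) := by field_simp
      _ ≤ l₁ / l₂ * (Real.exp (l₂ * T) - 1) := by
        gcongr
        linarith [Real.add_one_le_exp (l₂ * T)]
  have hcbf : ∀ t ∈ Set.Icc tk (tk + T),
      0 ≤ fderiv ℝ h (x t) (f (x t) + g (x t) uk) + α (h (x t)) := by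
    intro t ht
    have hdist : ‖x t - x tk‖ ≤ Δ * T := by
      have h_mvt := (convex_Icc tk (tk + T)).norm_image_sub_le_of_norm_hasDerivWithin_le
        hxderiv (fun s _ => hfg (x s)) htk ht
      refine h_mvt.trans (mul_le_mul_of_nonneg_left ?_ hΔ)
      rw [Real.norm_of_nonneg (by linarith [ht.1])]
      linarith [ht.2]
    have hf_le := neg_le_of_abs_le (hLf.norm_sub_le (x t) (x tk))
    have hg_le := neg_le_of_abs_le (hLg.norm_clm_apply_sub_le humax (x t) (x tk))
    have hα_le := neg_le_of_abs_le (hLα.norm_sub_le (x t) (x tk))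
    have htotal : (l₂ + lα) * ‖x t - x tk‖ ≤ l₁ * T := by
      calc (l₂ + lα) * ‖x t - x tk‖ ≤ (l₂ + lα) * (Δ * T) := by gcongr
        _ = l₁ * T := by rw [hl₁, hl₂]; ring
    rw [hl₂] at htotal
    simp only [ContinuousLinearMap.comp_apply] at hg_le hcond
    rw [map_add]
    linarith
  refine ⟨fun t ht => ?_, fun h0 => ?_⟩
  · rw [(hy t ht).derivWithin (uniqueDiffOn_Icc (by linarith) t ht)]
    exact hcbf t ht
  · exact nonneg_of_deriv_add_nonneg (fun r hr => hα0 ▸ hαMono hr) hy hcbf h0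
end
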